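/- arXiv:2110.00731 — 4 statements merged into one kernel-verified Lean document; each statement's English description precedes it below -/
import Mathlib

section
/- Let n be a positive integer and let ℝ^n carry the ℓ∞ norm. Let X ⊆ ℝ^n be compact, f̂ : ℝ^n → ℝ^n continuous, V : ℝ^n → ℝ continuous, and let γ ≥ 0, δ ≥ 0, r > 0. Assume: (i) V(x) > 0 for every x ∈ X with ‖x‖∞ ≥ r; (ii) V(f̂(x) + w) < V(x) for every x ∈ X with ‖x‖∞ ≥ r and every w ∈ ℝ^n with ‖w‖∞ ≤ γ‖x‖∞ + δ. Let c, c' ∈ ℝ satisfy {x : V(x) ≤ c} ⊆ X, {x : V(x) ≤ c'} ⊆ X, and succ(B_r) ⊆ {x : V(x) ≤ c'}. Then for every trajectory (x_k, w_k)_{k∈ℕ} of the uncertain system with V(x_0) ≤ c, there exists K ∈ ℕ such that V(x_k) ≤ c' for all k ≥ K. -/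
/-- On a compact set, a strict decrease under all norm-bounded disturbances is uniform. -/
theorem exists_uniform_decrease {E : Type*} [NormedAddCommGroup E] [ProperSpace E]
    {X : Set E} (hX : IsCompact X) {f : E → E} (hf : Continuous f)
    {V : E → ℝ} (hV : Continuous V) {γ δ r : ℝ} (hγ : 0 ≤ γ)
    (hdec : ∀ x ∈ X, r ≤ ‖x‖ → ∀ w : E, ‖w‖ ≤ γ * ‖x‖ + δ → V (f x + w) < V x) :
    ∃ ε > 0, ∀ x ∈ X, r ≤ ‖x‖ → ∀ w : E, ‖w‖ ≤ γ * ‖x‖ + δ → V (f x + w) + ε ≤ V x := by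
  obtain ⟨M, hM⟩ := hX.isBounded.exists_norm_le
  have hD : IsCompact {p : E × E | p.1 ∈ X ∧ r ≤ ‖p.1‖ ∧ ‖p.2‖ ≤ γ * ‖p.1‖ + δ} := by
    refine (hX.prod (isCompact_closedBall (0 : E) (γ * M + δ))).of_isClosed_subset ?_ ?_
    · have hr : IsClosed {p : E × E | r ≤ ‖p.1‖} := isClosed_le (by fun_prop) (by fun_prop)
      have hw : IsClosed {p : E × E | ‖p.2‖ ≤ γ * ‖p.1‖ + δ} :=
        isClosed_le (by fun_prop) (by fun_prop)
      exact (hX.isClosed.preimage continuous_fst).inter (hr.inter hw)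
    · rintro ⟨x, w⟩ ⟨hx, -, hw⟩
      refine ⟨hx, mem_closedBall_zero_iff.2 (hw.trans ?_)⟩
      gcongr
      exact hM x hx
  obtain ⟨ε, hε, h⟩ := hD.exists_forall_le' (f := fun p => V p.1 - V (f p.1 + p.2))
    (by fun_prop) (a := 0) fun p hp => sub_pos.2 (hdec p.1 hp.1 hp.2.1 p.2 hp.2.2)
  exact ⟨ε, hε, fun x hx hr w hw => by linarith [h (x, w) ⟨hx, hr, hw⟩]⟩


/-- Theorem 1 of the paper: a robust Lyapunov function certifies that every
trajectory of the uncertain system starting in the sublevel set `{V ≤ c} ⊆ X`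
eventually remains in any sublevel set `{V ≤ c'} ⊆ X` containing `succ(B_r)`. -/
theorem robust_lyapunov_convergence
    (n : ℕ) (hn : 0 < n)
    (X : Set (Fin n → ℝ)) (hX : IsCompact X)
    (fhat : (Fin n → ℝ) → (Fin n → ℝ)) (hfhat : Continuous fhat)
    (V : (Fin n → ℝ) → ℝ) (hV : Continuous V)
    (γ δ r : ℝ) (hγ : 0 ≤ γ) (hδ : 0 ≤ δ) (hr : 0 < r)
    (hpos : ∀ x ∈ X, r ≤ ‖x‖ → 0 < V x)
    (hdec : ∀ x ∈ X, r ≤ ‖x‖ →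
      ∀ w : Fin n → ℝ, ‖w‖ ≤ γ * ‖x‖ + δ → V (fhat x + w) < V x)
    (c c' : ℝ)
    (hc : {x : Fin n → ℝ | V x ≤ c} ⊆ X)
    (hc' : {x : Fin n → ℝ | V x ≤ c'} ⊆ X)
    (hsucc : ∀ x w : Fin n → ℝ, ‖x‖ ≤ r → ‖w‖ ≤ γ * ‖x‖ + δ →
      fhat x + w ∈ {x : Fin n → ℝ | V x ≤ c'})
    (x w : ℕ → Fin n → ℝ)
    (htraj : ∀ k, x (k + 1) = fhat (x k) + w k)
    (hw : ∀ k, ‖w k‖ ≤ γ * ‖x k‖ + δ)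
    (h0 : V (x 0) ≤ c) :
    ∃ K : ℕ, ∀ k ≥ K, V (x k) ≤ c' := by
  have step_le {a : ℝ} (hca : c' ≤ a) (haX : ∀ y, V y ≤ a → y ∈ X) {k : ℕ}
      (hk : V (x k) ≤ a) : V (x (k + 1)) ≤ a := by
    rw [htraj]
    rcases le_total ‖x k‖ r with h | h
    · exact (hsucc _ _ h (hw k)).trans hca
    · exact (hdec _ (haX _ hk) h _ (hw k)).le.trans hk
  have hmem (k : ℕ) : x k ∈ X := by
    have hmaxX (y) (hy : V y ≤ max c c') : y ∈ X :=
      (le_max_iff.1 hy).elim (fun h => hc h) fun h => hc' h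
    refine hmaxX _ ?_
    induction k with
    | zero => exact h0.trans (le_max_left _ _)
    | succ k ih => exact step_le (le_max_right _ _) hmaxX ih
  suffices h : ∃ K, V (x K) ≤ c' by
    obtain ⟨K, hK⟩ := h
    exact ⟨K, fun k hk => Nat.le_induction hK
      (fun _ _ ih => step_le le_rfl (fun _ hy => hc' hy) ih) k hk⟩
  by_contra! hgt
  obtain ⟨ε, hε, hunif⟩ := exists_uniform_decrease hX hfhat hV hγ hdec
  have hdecay (k : ℕ) : V (x k) + k * ε ≤ V (x 0) := by
    induction k with
    | zero => simp
    | succ k ih =>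
      have hrk : r ≤ ‖x k‖ := by
        by_contra! h
        exact (hgt (k + 1)).not_ge (htraj k ▸ hsucc _ _ h.le (hw k))
      have := hunif _ (hmem k) hrk _ (hw k)
      rw [← htraj] at this
      push_cast
      linarith
  obtain ⟨N, hN⟩ := exists_nat_gt ((V (x 0) - c') / ε)
  rw [div_lt_iff₀ hε] at hN
  linarith [hdecay N, hgt N]
end

section
/- Let n be a positive integer and let ℝ^n carry the ℓ∞ norm. Let X ⊆ ℝ^n, f̂ : ℝ^n → ℝ^n, V : ℝ^n → ℝ, γ ≥ 0, δ ≥ 0, r ∈ ℝ, c ≥ 0, and η > 0. Assume: (i) {x : V(x) ≤ c} ⊆ X; (ii) V(x) > 0 for every x ∈ X with ‖x‖∞ ≥ r; (iii) V(f̂(x) + w) ≤ V(x) − η for every x ∈ X with ‖x‖∞ ≥ r and every w with ‖w‖∞ ≤ γ‖x‖∞ + δ. Then for every trajectory (x_k, w_k)_{k∈ℕ} of the uncertain system with V(x_0) ≤ c, there exists k ∈ ℕ with (k : ℝ) ≤ c/η + 1 and ‖x_k‖∞ < r. -/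
/-- Finite-time reaching: with a uniform Lyapunov decrease `η > 0`, every
trajectory starting in `{V ≤ c}` reaches the open ℓ∞ ball of radius `r`
within at most `c/η + 1` steps. -/
theorem finite_time_reaching
    (n : ℕ) (hn : 0 < n)
    (X : Set (Fin n → ℝ))
    (fhat : (Fin n → ℝ) → (Fin n → ℝ))
    (V : (Fin n → ℝ) → ℝ)
    (γ δ r : ℝ) (hγ : 0 ≤ γ) (hδ : 0 ≤ δ)
    (c : ℝ) (hc0 : 0 ≤ c) (η : ℝ) (hη : 0 < η)
    (hsub : {x : Fin n → ℝ | V x ≤ c} ⊆ X)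
    (hpos : ∀ x ∈ X, r ≤ ‖x‖ → 0 < V x)
    (hdec : ∀ x ∈ X, r ≤ ‖x‖ →
      ∀ w : Fin n → ℝ, ‖w‖ ≤ γ * ‖x‖ + δ → V (fhat x + w) ≤ V x - η)
    (x w : ℕ → Fin n → ℝ)
    (htraj : ∀ k, x (k + 1) = fhat (x k) + w k)
    (hw : ∀ k, ‖w k‖ ≤ γ * ‖x k‖ + δ)
    (h0 : V (x 0) ≤ c) :
    ∃ k : ℕ, (k : ℝ) ≤ c / η + 1 ∧ ‖x k‖ < r := by
  by_contra! hfar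
  have hle : ∀ k : ℕ, V (x k) ≤ c - k * η → V (x k) ≤ c := fun k hk =>
    hk.trans (sub_le_self c (by positivity))
  have hdecay : ∀ k : ℕ, (k : ℝ) ≤ c / η + 1 → V (x k) ≤ c - k * η := by
    intro k
    induction k with
    | zero => intro _; simpa using h0
    | succ k ih =>
      intro hk
      push_cast at hk ⊢
      have hk' : (k : ℝ) ≤ c / η + 1 := by linarith
      have hstep := hdec (x k) (hsub (hle k (ih hk'))) (hfar k hk') (w k) (hw k)
      rw [htraj k]
      linarith [ih hk']
  have hN : ((⌊c / η⌋₊ + 1 : ℕ) : ℝ) ≤ c / η + 1 := by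
    push_cast
    gcongr
    exact Nat.floor_le (by positivity)
  have hlt : c < ((⌊c / η⌋₊ + 1 : ℕ) : ℝ) * η := by
    rw [← div_lt_iff₀ hη]
    exact_mod_cast Nat.lt_floor_add_one (c / η)
  have hV := hdecay _ hN
  linarith [hpos _ (hsub (hle _ hV)) (hfar _ hN)]
end

section
/- Let n be a positive integer and let a, z, m, M ∈ ℝ^n satisfy m_i ≤ a_i ≤ M_i for every i. Then z_i = max(a_i, 0) for every i if and only if there exists t ∈ ℝ^n with t_i ∈ {0, 1} for every i such that for every i: z_i ≥ a_i, z_i ≤ a_i − m_i (1 − t_i), z_i ≥ 0, and z_i ≤ M_i t_i. -/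
/-- Mixed-integer linear reformulation of the ReLU activation (equation (9)):
given element-wise bounds `m ≤ a ≤ M` on the pre-activation, `z = max(a, 0)`
holds iff there exist binary variables `t` satisfying the four linear
inequalities. -/
theorem relu_mil_reformulation
    (n : ℕ) (hn : 0 < n)
    (a z m M : Fin n → ℝ)
    (hbound : ∀ i, m i ≤ a i ∧ a i ≤ M i) :
    (∀ i, z i = max (a i) 0) ↔
      ∃ t : Fin n → ℝ, (∀ i, t i = 0 ∨ t i = 1) ∧
        ∀ i, z i ≥ a i ∧ z i ≤ a i - m i * (1 - t i) ∧ z i ≥ 0 ∧ z i ≤ M i * t i := by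
  constructor
  · intro hz
    refine ⟨fun i => if 0 < a i then 1 else 0, fun i => ?_, fun i => ?_⟩
    · by_cases h : 0 < a i <;> simp [h]
    · obtain ⟨hm, hM⟩ := hbound i
      by_cases h : 0 < a i
      · simp only [hz i, max_eq_left h.le, h, if_true]
        refine ⟨?_, ?_, ?_, ?_⟩ <;> linarith
      · have ha : a i ≤ 0 := not_lt.mp h
        simp only [hz i, max_eq_right ha, h, if_false]
        refine ⟨?_, ?_, ?_, ?_⟩ <;> linarith
  · rintro ⟨t, ht, h⟩ i
    obtain ⟨hza, hzm, hz0, hzM⟩ := h i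
    refine le_antisymm ?_ (max_le hza hz0)
    rcases ht i with h0 | h1
    · rw [h0, mul_zero] at hzM
      exact le_max_of_le_right hzM
    · rw [h1, sub_self, mul_zero, sub_zero] at hzm
      exact le_max_of_le_left hzm
end

section
/- Let n be a positive integer and let ℝ^n carry the ℓ∞ norm. Let X ⊆ ℝ^n be compact, f : ℝ^n → ℝ^n, f̂ : ℝ^n → ℝ^n continuous, V : ℝ^n → ℝ continuous, and γ ≥ 0, δ ≥ 0, r > 0. Assume: (i) ‖f(x) − f̂(x)‖∞ ≤ γ‖x‖∞ + δ for every x ∈ X; (ii) V(x) > 0 for every x ∈ X with ‖x‖∞ ≥ r; (iii) V(f̂(x) + w) < V(x) for every x ∈ X with ‖x‖∞ ≥ r and every w with ‖w‖∞ ≤ γ‖x‖∞ + δ. Let c, c' ∈ ℝ satisfy {x : V(x) ≤ c} ⊆ X, {x : V(x) ≤ c'} ⊆ X, and succ(B_r) ⊆ {x : V(x) ≤ c'}. Then for every sequence x : ℕ → ℝ^n with x_{k+1} = f(x_k) for all k and V(x_0) ≤ c, there exists K ∈ ℕ such that V(x_k) ≤ c' for all k ≥ K. -/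
/-- A robust decrease condition over a compact set is uniform: the decrease of `V` along
`fhat x + w` is bounded below by a positive constant. -/
theorem exists_uniform_robust_decrease {E : Type*} [NormedAddCommGroup E] [ProperSpace E]
    {X : Set E} (hX : IsCompact X) {fhat : E → E} (hfhat : Continuous fhat)
    {V : E → ℝ} (hV : Continuous V) {γ δ r : ℝ} (hγ : 0 ≤ γ)
    (hdec : ∀ x ∈ X, r ≤ ‖x‖ → ∀ w : E, ‖w‖ ≤ γ * ‖x‖ + δ → V (fhat x + w) < V x) :
    ∃ ε > 0, ∀ x ∈ X, r ≤ ‖x‖ → ∀ w : E, ‖w‖ ≤ γ * ‖x‖ + δ → V (fhat x + w) + ε ≤ V x := by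
  obtain ⟨M, hM⟩ := hX.isBounded.exists_norm_le
  let S : Set (E × E) := (X ×ˢ Metric.closedBall 0 (γ * M + δ)) ∩
    ({p | r ≤ ‖p.1‖} ∩ {p | ‖p.2‖ ≤ γ * ‖p.1‖ + δ})
  have hS : IsCompact S := (hX.prod (isCompact_closedBall 0 _)).inter_right <|
    (isClosed_le (by fun_prop) (by fun_prop)).inter (isClosed_le (by fun_prop) (by fun_prop))
  obtain ⟨ε, hε, h⟩ := hS.exists_forall_le' (f := fun p => V p.1 - V (fhat p.1 + p.2)) (a := 0)
    (by fun_prop) fun p hp => sub_pos.2 (hdec p.1 hp.1.1 hp.2.1 p.2 hp.2.2)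
  refine ⟨ε, hε, fun x hx hrx w hw => ?_⟩
  have hwM : ‖w‖ ≤ γ * M + δ := by
    have := mul_le_mul_of_nonneg_left (hM x hx) hγ
    linarith
  have := h (x, w) ⟨⟨hx, by simpa using hwM⟩, hrx, hw⟩
  dsimp only at this
  linarith


/-- Under Assumption 1, a robust Lyapunov function for the uncertain neural
network approximation system certifies convergence of the original nonlinear
system `x_+ = f(x)`: trajectories of `f` starting in `{V ≤ c} ⊆ X` eventually
remain in the sublevel set `{V ≤ c'}` containing `succ(B_r)`. -/
theorem roa_certificate_for_true_dynamics
    (n : ℕ) (hn : 0 < n)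
    (X : Set (Fin n → ℝ)) (hX : IsCompact X)
    (f fhat : (Fin n → ℝ) → (Fin n → ℝ)) (hfhat : Continuous fhat)
    (V : (Fin n → ℝ) → ℝ) (hV : Continuous V)
    (γ δ r : ℝ) (hγ : 0 ≤ γ) (hδ : 0 ≤ δ) (hr : 0 < r)
    (happrox : ∀ x ∈ X, ‖f x - fhat x‖ ≤ γ * ‖x‖ + δ)
    (hpos : ∀ x ∈ X, r ≤ ‖x‖ → 0 < V x)
    (hdec : ∀ x ∈ X, r ≤ ‖x‖ →
      ∀ w : Fin n → ℝ, ‖w‖ ≤ γ * ‖x‖ + δ → V (fhat x + w) < V x)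
    (c c' : ℝ)
    (hc : {x : Fin n → ℝ | V x ≤ c} ⊆ X)
    (hc' : {x : Fin n → ℝ | V x ≤ c'} ⊆ X)
    (hsucc : ∀ x w : Fin n → ℝ, ‖x‖ ≤ r → ‖w‖ ≤ γ * ‖x‖ + δ →
      fhat x + w ∈ {x : Fin n → ℝ | V x ≤ c'})
    (x : ℕ → Fin n → ℝ)
    (htraj : ∀ k, x (k + 1) = f (x k))
    (h0 : V (x 0) ≤ c) :
    ∃ K : ℕ, ∀ k ≥ K, V (x k) ≤ c' := by
  obtain ⟨ε, hε, hunif⟩ := exists_uniform_robust_decrease hX hfhat hV hγ hdec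
  have hout : ∀ y ∈ X, r ≤ ‖y‖ → V (f y) + ε ≤ V y := fun y hy hry => by
    simpa using hunif y hy hry (f y - fhat y) (happrox y hy)
  have hin : ∀ y ∈ X, ‖y‖ ≤ r → V (f y) ≤ c' := fun y hy hyr => by
    simpa using hsucc y (f y - fhat y) hyr (happrox y hy)
  have hinv : ∀ y, V y ≤ c' → V (f y) ≤ c' := fun y hy => by
    rcases le_total ‖y‖ r with h | h
    · exact hin y (hc' hy) h
    · linarith [hout y (hc' hy) h]
  suffices h : ∃ K, V (x K) ≤ c' by
    obtain ⟨K, hK⟩ := h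
    refine ⟨K, fun k hk => ?_⟩
    induction k, hk using Nat.le_induction with
    | base => exact hK
    | succ k _ ih => exact htraj k ▸ hinv _ ih
  by_contra! hcon
  have hfar : ∀ k, x k ∈ X → r ≤ ‖x k‖ := fun k hk => by
    by_contra! h
    exact (hcon (k + 1)).not_ge (htraj k ▸ hin _ hk h.le)
  have hdecay : ∀ k : ℕ, V (x k) + k * ε ≤ c := fun k => by
    induction k with
    | zero => simpa using h0
    | succ k ih =>
      have hk : x k ∈ X := hc (by
        have : 0 ≤ (k : ℝ) * ε := by positivity
        exact (by linarith : V (x k) ≤ c))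
      have := hout _ hk (hfar k hk)
      rw [htraj]
      push_cast
      linarith
  obtain ⟨k, hk⟩ := exists_nat_gt (c / ε)
  rw [div_lt_iff₀ hε] at hk
  have hkX : x k ∈ X := hc (by
    have : 0 ≤ (k : ℝ) * ε := by positivity
    exact (by linarith [hdecay k] : V (x k) ≤ c))
  linarith [hpos _ hkX (hfar k hkX), hdecay k]
end
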